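/- M-uniform geometric recurrence when the slow rate is not stabilising: assume in addition μ1 ≤ λ < μ2 and μ = μ2. Let ζ satisfy 1 < ζ < min( (λ+β)/λ, μ/λ, ((λ + β/2 + μ1) + √((λ + β/2 + μ1)² − 4λμ1)) / (2λ) ), define M(i,0) = ζ^i/2 and M(i,1) = ζ^i, and set η = max{ 1 − λ + λζ − β, μ/ζ + (1 − λ − μ) + λζ, μ1/ζ + (1 − λ − β/2 − μ1) + λζ }. Then η < 1, and for every action a ∈ {μ1, μ2} and every state x ∈ ℕ × {0,1}, the taboo drift inequality holds: ∑_{y ≠ (0,0)} p^a(x,y)·M(y) ≤ η·M(x). -/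

import Mathlib

/-- One-step transition probabilities of the uniformised M/M/1 queue with a temporary
control period, under action (service rate) `a ∈ {μ1, μ2}` in the control states.
States are pairs `(i, q)` with `q = true` the control state and `q = false` the
state without control (where the fixed rate `mu` is used). -/
noncomputable def trP (lam beta mu a : ℝ) : ℕ × Bool → ℕ × Bool → ℝ
  | (i, true), (j, true) =>
      if j = i + 1 then lam
      else if j + 1 = i then a
      else if j = i then 1 - lam - beta - (if i = 0 then 0 else a)
      else 0
  | (i, true), (j, false) => if j = i then beta else 0
  | (i, false), (j, false) =>
      if j = i + 1 then lam
      else if j + 1 = i then mu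
      else if j = i then 1 - lam - (if i = 0 then 0 else mu)
      else 0
  | (_, false), (_, true) => 0

/-- The weight function `M(i,0) = ζ^i/2`, `M(i,1) = ζ^i`. -/
noncomputable def Mwt (ζ : ℝ) : ℕ × Bool → ℝ
  | (i, false) => ζ ^ i / 2
  | (i, true) => ζ ^ i

/-- A quadratic that is negative at `1` stays negative between `1` and its larger root. -/
theorem quadratic_neg_of_lt_larger_root {a b c x : ℝ} (ha : 0 < a) (h1 : a + c < b)
    (hx1 : 1 < x) (hx : x < (b + Real.sqrt (b ^ 2 - 4 * a * c)) / (2 * a)) :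
    a * x ^ 2 - b * x + c < 0 := by
  have hD : (2 * a - b) ^ 2 < b ^ 2 - 4 * a * c := by nlinarith
  have hroot : -Real.sqrt (b ^ 2 - 4 * a * c) < 2 * a - b :=
    Real.neg_sqrt_lt_of_sq_lt hD
  rw [lt_div_iff₀ (by positivity)] at hx
  have hsq : (2 * a * x - b) ^ 2 < b ^ 2 - 4 * a * c := by
    rw [← Real.sq_sqrt ((sq_nonneg _).trans hD.le)]
    exact sq_lt_sq' (by nlinarith) (by linarith)
  nlinarith

/-- The taboo sum out of `(0, 1)`. -/
theorem tsum_taboo_zero_true (lam beta mu a ζ : ℝ) :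
    (∑' y : ℕ × Bool,
      if y = ((0 : ℕ), false) then 0 else trP lam beta mu a (0, true) y * Mwt ζ y) =
      lam * ζ + (1 - lam - beta) := by
  rw [tsum_eq_sum (s := {(1, true), (0, true)})]
  · simp [trP, Mwt]
  · rintro ⟨j, _ | _⟩ hj
    · simp +contextual [trP]
    · simp_all [trP]

/-- The taboo sum out of `(n + 1, 1)`. -/
theorem tsum_taboo_succ_true (lam beta mu a ζ : ℝ) (n : ℕ) :
    (∑' y : ℕ × Bool,
      if y = ((0 : ℕ), false) then 0 else trP lam beta mu a (n + 1, true) y * Mwt ζ y) =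
      lam * ζ ^ (n + 2) + (1 - lam - beta - a) * ζ ^ (n + 1) + a * ζ ^ n
        + beta * (ζ ^ (n + 1) / 2) := by
  rw [tsum_eq_sum (s := {(n + 2, true), (n + 1, true), (n, true), (n + 1, false)})]
  · simp [trP, Mwt, add_assoc]
  · rintro ⟨j, _ | _⟩ hj <;> simp_all [trP]

/-- The taboo sum out of `(0, 0)`. -/
theorem tsum_taboo_zero_false (lam beta mu a ζ : ℝ) :
    (∑' y : ℕ × Bool,
      if y = ((0 : ℕ), false) then 0 else trP lam beta mu a (0, false) y * Mwt ζ y) =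
      lam * (ζ / 2) := by
  rw [tsum_eq_sum (s := {(1, false)})]
  · simp [trP, Mwt]
  · rintro ⟨j, _ | _⟩ hj <;> simp_all [trP]

/-- The taboo sum out of `(n + 1, 0)`. -/
theorem tsum_taboo_succ_false (lam beta mu a ζ : ℝ) (n : ℕ) :
    (∑' y : ℕ × Bool,
      if y = ((0 : ℕ), false) then 0 else trP lam beta mu a (n + 1, false) y * Mwt ζ y) =
      lam * (ζ ^ (n + 2) / 2) + (1 - lam - mu) * (ζ ^ (n + 1) / 2)
        + if n = 0 then 0 else mu * (ζ ^ n / 2) := by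
  rw [tsum_eq_sum (s := {(n + 2, false), (n + 1, false), (n, false)})]
  · simp [trP, Mwt, add_assoc]
  · rintro ⟨j, _ | _⟩ hj <;> simp_all [trP]

/-- `M`-uniform geometric recurrence when the slow rate is not stabilising
(`μ1 ≤ λ < μ2` and `μ = μ2`): the taboo drift inequality
`∑_{y ≠ (0,0)} p^a(x,y) M(y) ≤ η M(x)` holds with `η < 1`. -/
theorem stmt11
    (lam mu1 mu2 beta mu : ℝ)
    (hlam : 0 < lam) (hmu1 : 0 < mu1) (hmu12 : mu1 < mu2) (hbeta : 0 < beta)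
    (hsum : lam + mu1 + mu2 + beta = 1)
    (hmueq : mu = mu2) (hstab : lam < mu) (hunstab : mu1 ≤ lam)
    (ζ : ℝ) (hζ1 : 1 < ζ)
    (hζ2 : ζ < min (min ((lam + beta) / lam) (mu / lam))
      (((lam + beta / 2 + mu1) +
          Real.sqrt ((lam + beta / 2 + mu1) ^ 2 - 4 * lam * mu1)) / (2 * lam)))
    (η : ℝ)
    (hη : η = max (max (1 - lam + lam * ζ - beta)
        (mu / ζ + (1 - lam - mu) + lam * ζ))
        (mu1 / ζ + (1 - lam - beta / 2 - mu1) + lam * ζ)) :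
    η < 1 ∧
      ∀ a : ℝ, (a = mu1 ∨ a = mu2) → ∀ x : ℕ × Bool,
        (∑' y : ℕ × Bool,
            if y = ((0 : ℕ), false) then 0 else trP lam beta mu a x y * Mwt ζ y) ≤
          η * Mwt ζ x := by
  have hζ0 : 0 < ζ := by linarith
  obtain ⟨⟨hζa, hζb⟩, hζc⟩ := (lt_min_iff.mp hζ2).imp_left lt_min_iff.mp
  rw [lt_div_iff₀ hlam] at hζa hζb
  have h1 : 1 - lam + lam * ζ - beta ≤ η := hη ▸ (le_max_left _ _).trans (le_max_left _ _)
  have h2 : mu / ζ + (1 - lam - mu) + lam * ζ ≤ η :=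
    hη ▸ (le_max_right _ _).trans (le_max_left _ _)
  have h3 : mu1 / ζ + (1 - lam - beta / 2 - mu1) + lam * ζ ≤ η := hη ▸ le_max_right _ _
  refine ⟨?_, ?_⟩
  · rw [hη]
    refine max_lt (max_lt (by linarith) ?_) ?_
    · suffices h : mu / ζ < lam + mu - lam * ζ by linarith
      rw [div_lt_iff₀ hζ0]
      nlinarith
    · suffices h : mu1 / ζ < lam + beta / 2 + mu1 - lam * ζ by linarith
      rw [div_lt_iff₀ hζ0]
      linarith [quadratic_neg_of_lt_larger_root hlam (by linarith) hζ1 hζc]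
  · rintro a ha ⟨_ | n, _ | _⟩
    · rw [tsum_taboo_zero_false]
      simp only [Mwt, pow_zero]
      linarith
    · rw [tsum_taboo_zero_true]
      simp only [Mwt, pow_zero]
      linarith
    · rw [tsum_taboo_succ_false]
      have hdrop : (if n = 0 then 0 else mu * (ζ ^ n / 2)) ≤ mu * (ζ ^ n / 2) := by
        split_ifs
        · exact mul_nonneg (by linarith) (by positivity)
        · exact le_rfl
      have hmul := mul_le_mul_of_nonneg_right h2 (by positivity : 0 ≤ ζ ^ (n + 1) / 2)
      have hdiv : mu / ζ * (ζ ^ (n + 1) / 2) = mu * (ζ ^ n / 2) := by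
        field_simp
        ring
      simp only [Mwt]
      linear_combination hdrop + hmul - hdiv
    · have hn : (0 : ℝ) < ζ ^ n := by positivity
      have hle : mu1 ≤ a := by rcases ha with rfl | rfl <;> linarith
      rw [tsum_taboo_succ_true]
      have hslow : 0 ≤ (a - mu1) * (ζ ^ n * (ζ - 1)) :=
        mul_nonneg (by linarith) (mul_nonneg hn.le (by linarith))
      have hmul := mul_le_mul_of_nonneg_right h3 (by positivity : 0 ≤ ζ ^ (n + 1))
      have hdiv : mu1 / ζ * ζ ^ (n + 1) = mu1 * ζ ^ n := by
        field_simp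
        ring
      simp only [Mwt]
      linear_combination hslow + hmul - hdiv
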